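/- Let P_1,…,P_ℓ ∈ F⟨x_1,…,x_n⟩, where each P_i = L_{i,1}·L_{i,2}·⋯·L_{i,D} is a product of D homogeneous linear forms. Let T ⊆ {1,…,D} be a set of positions such that for every m ∉ T all the products have the same m-th factor, i.e., L_{i,m} = L_{i',m} for all i, i' ∈ {1,…,ℓ}, and this common linear form is nonzero. For each i let P'_i = Π_{m∈T} L_{i,m}, the product (in increasing order of m) of the factors at positions in T. Then for any scalars β_1,…,β_ℓ ∈ F: Σ_{i=1}^ℓ β_i P_i = 0 if and only if Σ_{i=1}^ℓ β_i P'_i = 0. -/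

import Mathlib

/-!
STATEMENT 8: If products `P_i = L_{i,1}⋯L_{i,D}` of homogeneous linear forms all share the
same nonzero factor at each position `m ∉ T`, then for any scalars `β_i`,
`∑ β_i P_i = 0` iff `∑ β_i P'_i = 0`, where `P'_i` is the product (in increasing order of
position) of the factors of `P_i` at the positions in `T`.
-/

noncomputable section

/-- The free noncommutative polynomial algebra `F⟨x_1,…,x_n⟩`, realized as the monoid
algebra of the free monoid of words over `Fin n`. -/
abbrev FreeNC (F : Type*) [CommSemiring F] (n : ℕ) : Type _ :=
  MonoidAlgebra F (FreeMonoid (Fin n))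

/-- The homogeneous linear form `∑ i, c i * x i` in `F⟨x_1,…,x_n⟩`. -/
def linForm {F : Type*} [CommSemiring F] {n : ℕ} (c : Fin n → F) : FreeNC F n :=
  ∑ i, MonoidAlgebra.single (FreeMonoid.of i) (c i)

section LinForm

variable {F : Type*} [CommSemiring F] {n : ℕ}

lemma coeff_linForm_mul_of_mul (c : Fin n → F) (p : FreeNC F n) (x : Fin n)
    (t : FreeMonoid (Fin n)) :
    (linForm c * p).coeff (FreeMonoid.of x * t) = c x * p.coeff t := by
  rw [linForm, Finset.sum_mul, MonoidAlgebra.coeff_sum, Finsupp.finsetSum_apply,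
    Finset.sum_eq_single x]
  · exact MonoidAlgebra.coeff_single_mul_mul _ _ _ _
  · intro y _ hy
    refine MonoidAlgebra.coeff_single_mul_of_forall_mul_ne _ _ fun d hd => hy ?_
    have h := congrArg FreeMonoid.toList hd
    simp only [FreeMonoid.toList_of_mul] at h
    exact (List.cons.inj h).1
  · simp

lemma coeff_linForm_mul_one (c : Fin n → F) (p : FreeNC F n) :
    (linForm c * p).coeff 1 = 0 := by
  rw [linForm, Finset.sum_mul, MonoidAlgebra.coeff_sum, Finsupp.finsetSum_apply]
  refine Finset.sum_eq_zero fun y _ => ?_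
  refine MonoidAlgebra.coeff_single_mul_of_forall_mul_ne _ _ fun d hd => ?_
  have h := congrArg FreeMonoid.toList hd
  simp at h

variable {ι : Type*}

lemma coeff_prod_linForm (c : ι → Fin n → F) (w : ι → Fin n) (ms : List ι) :
    (ms.map fun m => linForm (c m)).prod.coeff (FreeMonoid.ofList (ms.map w)) =
      (ms.map fun m => c m (w m)).prod := by
  induction ms with
  | nil => exact MonoidAlgebra.coeff_one_one
  | cons a ms ih =>
    simp only [List.map_cons, List.prod_cons, FreeMonoid.ofList_cons, coeff_linForm_mul_of_mul, ih]

lemma coeff_prod_linForm_of_length_ne (c : ι → Fin n → F) (ms : List ι)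
    (u : FreeMonoid (Fin n)) (hu : u.length ≠ ms.length) :
    (ms.map fun m => linForm (c m)).prod.coeff u = 0 := by
  induction ms generalizing u with
  | nil =>
    classical
    rw [List.map_nil, List.prod_nil, MonoidAlgebra.one_def, MonoidAlgebra.coeff_single,
      Finsupp.single_apply, if_neg]
    rintro rfl
    exact hu rfl
  | cons a ms ih =>
    rw [List.map_cons, List.prod_cons]
    cases u using FreeMonoid.casesOn with
    | one => exact coeff_linForm_mul_one _ _
    | of_mul x t =>
      rw [coeff_linForm_mul_of_mul, ih t, mul_zero]
      intro h
      apply hu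
      rw [FreeMonoid.length_mul, FreeMonoid.length_of, h, List.length_cons, add_comm]

end LinForm

lemma List.Nodup.exists_map_eq {ι α : Type*} [Nonempty α] {ms : List ι} (hms : ms.Nodup)
    (u : List α) (hu : u.length = ms.length) : ∃ w : ι → α, ms.map w = u := by
  classical
  induction ms generalizing u with
  | nil => exact ⟨fun _ => Classical.arbitrary α, (List.eq_nil_of_length_eq_zero hu).symm⟩
  | cons a ms ih =>
    cases u with
    | nil => simp at hu
    | cons x t =>
      obtain ⟨ha, hms⟩ := List.nodup_cons.1 hms
      obtain ⟨w, rfl⟩ := ih hms t (by simpa using hu)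
      refine ⟨Function.update w a x, ?_⟩
      rw [List.map_cons, Function.update_self]
      congr 1
      refine List.map_congr_left fun m hm => Function.update_of_ne ?_ _ _
      rintro rfl
      exact ha hm

/-- A linear combination of products of linear forms vanishes iff it vanishes at every choice of
one variable per position. -/
lemma sum_smul_prod_linForm_eq_zero_iff {F : Type*} [CommSemiring F] {n : ℕ} [Nonempty (Fin n)]
    {ι κ : Type*} [LinearOrder ι] [Fintype κ] (L : κ → ι → Fin n → F) (S : Finset ι) (β : κ → F) :
    (∑ i, β i • ((S.sort (· ≤ ·)).map fun m => linForm (L i m)).prod) = (0 : FreeNC F n) ↔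
      ∀ w : ι → Fin n, ∑ i, β i * ∏ m ∈ S, L i m (w m) = 0 := by
  have coeff_eq (u : FreeMonoid (Fin n)) :
      (∑ i, β i • ((S.sort (· ≤ ·)).map fun m => linForm (L i m)).prod : FreeNC F n).coeff u =
        ∑ i, β i * ((S.sort (· ≤ ·)).map fun m => linForm (L i m)).prod.coeff u := by
    rw [MonoidAlgebra.coeff_sum, Finsupp.finsetSum_apply]
    rfl
  have prod_eq (w : ι → Fin n) (i : κ) :
      ((S.sort (· ≤ ·)).map fun m => L i m (w m)).prod = ∏ m ∈ S, L i m (w m) := by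
    rw [← List.prod_toFinset _ (S.sort_nodup (· ≤ ·)), Finset.sort_toFinset]
  constructor
  · intro h w
    have hw := coeff_eq (FreeMonoid.ofList ((S.sort (· ≤ ·)).map w))
    simp only [h, coeff_prod_linForm, prod_eq] at hw
    exact hw.symm
  · intro h
    refine MonoidAlgebra.coeff_injective (Finsupp.ext fun u => ?_)
    rw [coeff_eq]
    by_cases hu : u.length = (S.sort (· ≤ ·)).length
    · obtain ⟨w, hw⟩ := (S.sort_nodup (· ≤ ·)).exists_map_eq u.toList hu
      obtain rfl : FreeMonoid.ofList ((S.sort (· ≤ ·)).map w) = u := by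
        rw [hw, FreeMonoid.ofList_toList]
      simp only [coeff_prod_linForm, prod_eq]
      exact h w
    · simp only [coeff_prod_linForm_of_length_ne _ _ u hu, mul_zero, Finset.sum_const_zero]
      rfl

theorem stmt8 {F : Type*} [Field F] {n l D : ℕ}
    (L : Fin l → Fin D → Fin n → F)
    (T : Finset (Fin D))
    (hsame : ∀ m ∉ T, ∀ i i' : Fin l, L i m = L i' m)
    (hnz : ∀ m ∉ T, ∀ i : Fin l, L i m ≠ 0)
    (β : Fin l → F) :
    (∑ i, β i • (List.ofFn fun m => linForm (L i m)).prod) = (0 : FreeNC F n) ↔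
      (∑ i, β i • ((T.sort (· ≤ ·)).map fun m => linForm (L i m)).prod)
        = (0 : FreeNC F n) := by
  rcases isEmpty_or_nonempty (Fin l) with hl | ⟨⟨i₀⟩⟩
  · simp
  have ofFn_eq (i : Fin l) : (List.ofFn fun m => linForm (L i m)) =
      ((Finset.univ : Finset (Fin D)).sort (· ≤ ·)).map fun m => linForm (L i m) := by
    rw [Fin.sort_univ, List.ofFn_eq_map]
  simp only [ofFn_eq]
  by_cases hT : T = Finset.univ
  · rw [hT]
  have exists_ne (m : Fin D) (hm : m ∉ T) : ∃ x, L i₀ m x ≠ 0 :=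
    Function.ne_iff.1 (hnz m hm i₀)
  have : Nonempty (Fin n) := by
    obtain ⟨m, hm⟩ := not_forall.1 (mt Finset.eq_univ_iff_forall.2 hT)
    exact (exists_ne m hm).nonempty
  have factor (w : Fin D → Fin n) : ∑ i, β i * ∏ m, L i m (w m) =
      (∏ m ∈ Tᶜ, L i₀ m (w m)) * ∑ i, β i * ∏ m ∈ T, L i m (w m) := by
    rw [Finset.mul_sum]
    refine Finset.sum_congr rfl fun i _ => ?_
    have hc : ∏ m ∈ Tᶜ, L i m (w m) = ∏ m ∈ Tᶜ, L i₀ m (w m) :=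
      Finset.prod_congr rfl fun m hm => by rw [hsame m (Finset.mem_compl.1 hm) i i₀]
    rw [← Finset.prod_mul_prod_compl T, hc]
    ring
  rw [sum_smul_prod_linForm_eq_zero_iff, sum_smul_prod_linForm_eq_zero_iff]
  constructor
  · intro h v
    choose x hx using exists_ne
    let w : Fin D → Fin n := fun m => if hm : m ∈ T then v m else x m hm
    have hw := h w
    rw [factor] at hw
    have hne : ∏ m ∈ Tᶜ, L i₀ m (w m) ≠ 0 := Finset.prod_ne_zero_iff.2 fun m hm => by
      have hm' := Finset.mem_compl.1 hm
      simpa only [w, dif_neg hm'] using hx m hm'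
    rw [← (mul_eq_zero.1 hw).resolve_left hne]
    refine Finset.sum_congr rfl fun i _ => congrArg (β i * ·) ?_
    exact Finset.prod_congr rfl fun m hm => by simp only [w, dif_pos hm]
  · intro h w
    rw [factor, h, mul_zero]

end
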